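/- arXiv:1803.08466 — 3 statements merged into one kernel-verified Lean document; each statement's English description precedes it below -/
import Mathlib

section
/- Let {f_k} (k ≥ 1) be a frame for an infinite-dimensional separable Hilbert space H with frame bounds A, B, and suppose the kernel of the synthesis operator is invariant under the right shift on ℓ²(ℕ). Then there exists a bounded operator T : H → H with T f_k = f_{k+1} for all k, and ‖T‖ ≤ √(B/A). -/
open scoped ComplexInnerProductSpace

/-- A sequence `f` in a Hilbert space is a frame if there exist constants
`A, B > 0` with `A‖x‖² ≤ ∑ᵢ |⟨x, f i⟩|² ≤ B‖x‖²` for all `x`. -/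
def IsFrame {ι H : Type*} [NormedAddCommGroup H] [InnerProductSpace ℂ H] (f : ι → H) : Prop :=
  ∃ A B : ℝ, 0 < A ∧ 0 < B ∧ ∀ x : H,
    A * ‖x‖ ^ 2 ≤ ∑' i, ‖⟪x, f i⟫‖ ^ 2 ∧ ∑' i, ‖⟪x, f i⟫‖ ^ 2 ≤ B * ‖x‖ ^ 2

/-- The analysis operator of a Bessel sequence, together with the series expansion of its
adjoint, the synthesis operator. -/
theorem exists_analysis_operator {H : Type*} [NormedAddCommGroup H] [InnerProductSpace ℂ H]
    [CompleteSpace H] {g : ℕ → H} {B : ℝ} (hB : 0 ≤ B)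
    (hs : ∀ x : H, Summable fun k => ‖⟪x, g k⟫‖ ^ 2)
    (hg : ∀ x : H, ∑' k, ‖⟪x, g k⟫‖ ^ 2 ≤ B * ‖x‖ ^ 2) :
    ∃ V : H →L[ℂ] lp (fun _ : ℕ => ℂ) 2,
      (∀ x, ‖V x‖ ^ 2 = ∑' k, ‖⟪x, g k⟫‖ ^ 2) ∧ ‖V‖ ≤ √B ∧
      (∀ c, HasSum (fun k => c k • g k) (ContinuousLinearMap.adjoint V c)) := by
  have hmem : ∀ x : H, Memℓp (fun k => ⟪g k, x⟫) 2 := fun x => by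
    rw [memℓp_gen_iff (by norm_num)]
    simpa [norm_inner_symm] using hs x
  let L : H →ₗ[ℂ] lp (fun _ : ℕ => ℂ) 2 :=
    { toFun := fun x => ⟨fun k => ⟪g k, x⟫, hmem x⟩
      map_add' := fun x y => by
        ext k
        exact inner_add_right (g k) x y
      map_smul' := fun a x => by
        ext k
        exact inner_smul_right (g k) x a }
  have hL : ∀ x, ‖L x‖ ^ 2 = ∑' k, ‖⟪x, g k⟫‖ ^ 2 := fun x => by
    have h := lp.norm_rpow_eq_tsum (p := 2) (by norm_num) (L x)
    simp only [ENNReal.toReal_ofNat, Real.rpow_ofNat] at h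
    rw [h]
    exact tsum_congr fun k => by rw [← norm_inner_symm]; rfl
  have hbound : ∀ x, ‖L x‖ ≤ √B * ‖x‖ := fun x => by
    refine le_of_sq_le_sq ?_ (by positivity)
    rw [hL, mul_pow, Real.sq_sqrt hB]
    exact hg x
  refine ⟨L.mkContinuous (√B) hbound, hL, L.mkContinuous_norm_le (Real.sqrt_nonneg B) hbound,
    fun c => ?_⟩
  have h := (ContinuousLinearMap.adjoint (L.mkContinuous (√B) hbound)).hasSum
    (lp.hasSum_single (p := 2) (by norm_num) c)
  convert h using 2 with k
  refine ext_inner_right ℂ fun x => ?_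
  rw [ContinuousLinearMap.adjoint_inner_left, lp.inner_single_left, inner_smul_left]
  change _ = ⟪c k, ⟪g k, x⟫⟫
  simp [mul_comm]

/-- If a frame `{f_k}` with bounds `A, B` for an infinite-dimensional separable Hilbert space
has the kernel of its synthesis operator invariant under the right shift, then there is a
bounded operator `T` with `T f_k = f_{k+1}` and `‖T‖ ≤ √(B/A)`. -/
theorem stmt3 {H : Type*} [NormedAddCommGroup H] [InnerProductSpace ℂ H] [CompleteSpace H]
    [TopologicalSpace.SeparableSpace H] (hdim : ¬ FiniteDimensional ℂ H)
    (f : ℕ → H) (A B : ℝ) (hA : 0 < A) (hB : 0 < B)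
    (hframe : ∀ x : H,
      A * ‖x‖ ^ 2 ≤ ∑' k, ‖⟪x, f k⟫‖ ^ 2 ∧ ∑' k, ‖⟪x, f k⟫‖ ^ 2 ≤ B * ‖x‖ ^ 2)
    (hker : ∀ c : ℕ → ℂ, Summable (fun k => ‖c k‖ ^ 2) →
      HasSum (fun k => c k • f k) (0 : H) → HasSum (fun k => c k • f (k + 1)) (0 : H)) :
    ∃ T : H →L[ℂ] H, (∀ k, T (f k) = f (k + 1)) ∧ ‖T‖ ≤ Real.sqrt (B / A) := by
  have hs : ∀ x : H, Summable fun k => ‖⟪x, f k⟫‖ ^ 2 := fun x => by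
    by_contra hx
    have h := (hframe x).1
    rw [tsum_eq_zero_of_not_summable hx] at h
    have hx0 : x = 0 := by
      by_contra hne
      have := norm_pos_iff.mpr hne
      exact absurd h (not_le.mpr (by positivity))
    simp [hx0, summable_zero] at hx
  have hs' : ∀ x : H, Summable fun k => ‖⟪x, f (k + 1)⟫‖ ^ 2 := fun x =>
    (summable_nat_add_iff 1).mpr (hs x)
  have hle : ∀ x : H, ∑' k, ‖⟪x, f (k + 1)⟫‖ ^ 2 ≤ B * ‖x‖ ^ 2 := fun x => by
    refine le_trans ?_ (hframe x).2
    rw [(hs x).tsum_eq_zero_add]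
    exact le_add_of_nonneg_left (by positivity)
  obtain ⟨V, hV, -, hVsum⟩ := exists_analysis_operator hB.le hs fun x => (hframe x).2
  obtain ⟨W, -, hW, hWsum⟩ := exists_analysis_operator hB.le hs' hle
  have hVlow : ∀ x, A * ‖x‖ ^ 2 ≤ ‖V x‖ ^ 2 := fun x => hV x ▸ (hframe x).1
  have hinner : ∀ x, ⟪(ContinuousLinearMap.adjoint V ∘L V) x, x⟫ = (‖V x‖ : ℂ) ^ 2 := fun x => by
    rw [ContinuousLinearMap.comp_apply, ContinuousLinearMap.adjoint_inner_left]
    exact inner_self_eq_norm_sq_to_K (V x)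
  have hunit : IsUnit (ContinuousLinearMap.adjoint V ∘L V) := by
    refine ContinuousLinearMap.isUnit_of_forall_le_norm_inner_map _ (c := ⟨A, hA.le⟩) hA fun x => ?_
    rw [hinner]
    change ‖x‖ ^ 2 * A ≤ _
    simpa [mul_comm] using hVlow x
  obtain ⟨R, hR⟩ := hunit.exists_right_inv
  have hUV : ∀ x, ContinuousLinearMap.adjoint V (V (R x)) = x := fun x => DFunLike.congr_fun hR x
  have hVR : ∀ x, ‖V (R x)‖ ≤ ‖x‖ / √A := fun x => by
    have h1 : ‖V (R x)‖ ^ 2 ≤ ‖x‖ * ‖R x‖ := by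
      have h := hinner (R x)
      rw [ContinuousLinearMap.comp_apply, hUV] at h
      have h' := norm_inner_le_norm (𝕜 := ℂ) x (R x)
      rw [h] at h'
      simpa using h'
    have h2 : √A * ‖R x‖ ≤ ‖V (R x)‖ := by
      refine le_of_sq_le_sq ?_ (norm_nonneg _)
      rw [mul_pow, Real.sq_sqrt hA.le]
      exact hVlow (R x)
    have hA' : 0 < √A := Real.sqrt_pos.mpr hA
    rw [le_div_iff₀ hA']
    by_contra! hlt
    have hpos : 0 < ‖V (R x)‖ :=
      pos_of_mul_pos_left ((norm_nonneg x).trans_lt hlt) hA'.le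
    nlinarith [mul_lt_mul_of_pos_right hlt hpos, mul_le_mul_of_nonneg_left h2 (norm_nonneg x)]
  refine ⟨ContinuousLinearMap.adjoint W ∘L V ∘L R, fun k => ?_, ?_⟩
  · set c : lp (fun _ : ℕ => ℂ) 2 := V (R (f k)) - lp.single 2 k 1 with hc
    have hsingle : ∀ g : ℕ → H,
        HasSum (fun j => (lp.single (E := fun _ : ℕ => ℂ) 2 k 1 : ℕ → ℂ) j • g j) (g k) := fun g => by
      convert hasSum_single k (f := fun j =>
        (lp.single (E := fun _ : ℕ => ℂ) 2 k 1 : ℕ → ℂ) j • g j) ?_ using 1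
      · simp
      · intro j hj
        simp [hj]
    have hzero : ContinuousLinearMap.adjoint V c = 0 := by
      rw [hc, map_sub, hUV, (hVsum _).unique (hsingle f), sub_self]
    have hcs : Summable fun j => ‖c j‖ ^ 2 := by
      simpa using (lp.memℓp c).summable (by norm_num)
    have h := (hWsum c).unique (hker c hcs (hzero ▸ hVsum c))
    rw [hc, map_sub, (hWsum _).unique (hsingle fun j => f (j + 1)), sub_eq_zero] at h
    exact h
  · refine ContinuousLinearMap.opNorm_le_bound _ (Real.sqrt_nonneg _) fun x => ?_
    calc ‖ContinuousLinearMap.adjoint W (V (R x))‖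
        ≤ ‖ContinuousLinearMap.adjoint W‖ * ‖V (R x)‖ := ContinuousLinearMap.le_opNorm _ _
      _ ≤ √B * (‖x‖ / √A) := by
          rw [LinearIsometryEquiv.norm_map]
          exact mul_le_mul hW (hVR x) (norm_nonneg _) (Real.sqrt_nonneg _)
      _ = √(B / A) * ‖x‖ := by
          rw [Real.sqrt_div hB.le]
          ring
end

section
/- Let {T^n φ} (n ≥ 0) be a frame for a Hilbert space H with T : H → H bounded. Then for every k ≥ 0, the range of T^k equals the closed span of {T^n φ : n ≥ k}; in particular ran(T^k) is closed. -/
open scoped ComplexInnerProductSpace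

/-- An operator whose adjoint is bounded below on the orthogonal complement of a finite-dimensional
subspace has closed range. -/
theorem isClosed_range_of_adjoint_bounded_below {H : Type*} [NormedAddCommGroup H]
    [InnerProductSpace ℂ H] [CompleteSpace H] (L : H →L[ℂ] H) (F : Submodule ℂ H)
    [FiniteDimensional ℂ F] {c : ℝ} (hc : 0 < c)
    (h : ∀ x ∈ Fᗮ, c * ‖x‖ ^ 2 ≤ ‖L.adjoint x‖ ^ 2) :
    IsClosed (L.range : Set H) := by
  let S : Fᗮ →L[ℂ] H := L ∘L L.adjoint ∘L Fᗮ.subtypeL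
  have hS (x : Fᗮ) : c * ‖x‖ ^ 2 ≤ ‖⟪(x : H), S x⟫‖ := by
    have : ⟪(x : H), S x⟫ = (‖L.adjoint x‖ ^ 2 : ℝ) := by
      change ⟪(x : H), L (L.adjoint x)⟫ = _
      rw [← ContinuousLinearMap.adjoint_inner_left, inner_self_eq_norm_sq_to_K]
      norm_cast
    rw [this, Complex.norm_real, Real.norm_of_nonneg (by positivity)]
    exact h x x.2
  have hanti : AntilipschitzWith (Real.toNNReal c⁻¹) S := by
    refine S.antilipschitz_of_bound fun x => ?_
    rw [Real.coe_toNNReal _ (by positivity), inv_mul_eq_div, le_div_iff₀ hc]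
    rcases (norm_nonneg x).eq_or_lt with hx | hx
    · rw [← hx, zero_mul]
      positivity
    · refine le_of_mul_le_mul_left ?_ hx
      calc ‖x‖ * (‖x‖ * c) = c * ‖x‖ ^ 2 := by ring
        _ ≤ _ := (hS x).trans (norm_inner_le_norm _ _)
  have hN : IsClosed (S.range : Set H) := hanti.isClosed_range S.uniformContinuous
  have hNL : S.range ≤ L.range := by
    rintro _ ⟨x, rfl⟩
    exact ⟨L.adjoint x, rfl⟩
  have htop : S.range ⊔ F = ⊤ := by
    have hcl := Submodule.isClosed_sup_finiteDimensional S.range F hN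
    rw [← hcl.submodule_topologicalClosure_eq, Submodule.topologicalClosure_eq_top_iff,
      ← Submodule.inf_orthogonal, eq_bot_iff]
    rintro y ⟨hyS, hyF⟩
    have := hS ⟨y, hyF⟩
    have hy0 : ⟪y, S ⟨y, hyF⟩⟫ = 0 :=
      Submodule.inner_left_of_mem_orthogonal (K := S.range) ⟨_, rfl⟩ hyS
    rw [hy0, norm_zero] at this
    have hy : ‖y‖ ^ 2 ≤ 0 := nonpos_of_mul_nonpos_right this hc
    simpa using le_antisymm hy (by positivity)
  have hrange : L.range = S.range ⊔ F ⊓ L.range := by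
    rw [← sup_inf_assoc_of_le F hNL, htop, top_inf_eq]
  rw [hrange]
  exact Submodule.isClosed_sup_finiteDimensional _ _ hN

namespace IsFrame

variable {ι H : Type*} [NormedAddCommGroup H] [InnerProductSpace ℂ H] {f : ι → H}

theorem summable_norm_inner_sq (hf : IsFrame f) (x : H) :
    Summable fun i => ‖⟪x, f i⟫‖ ^ 2 := by
  obtain ⟨A, B, hA, -, h⟩ := hf
  by_contra hs
  have hx := (h x).1
  rw [tsum_eq_zero_of_not_summable hs] at hx
  have hx0 : ‖x‖ ^ 2 = 0 := le_antisymm (nonpos_of_mul_nonpos_right hx hA) (by positivity)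
  obtain rfl : x = 0 := by simpa using hx0
  exact hs (by simp)

theorem topologicalClosure_span_eq_top [CompleteSpace H] (hf : IsFrame f) :
    (Submodule.span ℂ (Set.range f)).topologicalClosure = ⊤ := by
  obtain ⟨A, B, hA, -, h⟩ := hf
  rw [Submodule.topologicalClosure_eq_top_iff, eq_bot_iff]
  intro x hx
  have hx1 := (h x).1
  have h0 (i) : ⟪x, f i⟫ = 0 :=
    Submodule.inner_left_of_mem_orthogonal (Submodule.subset_span (Set.mem_range_self i)) hx
  simp only [h0, norm_zero, ne_eq, OfNat.ofNat_ne_zero, not_false_eq_true, zero_pow,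
    tsum_zero] at hx1
  have hx0 : ‖x‖ ^ 2 = 0 := le_antisymm (nonpos_of_mul_nonpos_right hx1 hA) (by positivity)
  simpa using hx0

end IsFrame

/-- The powers of an operator with a frame orbit have closed range. -/
theorem IsFrame.isClosed_range_pow {H : Type*} [NormedAddCommGroup H] [InnerProductSpace ℂ H]
    [CompleteSpace H] {T : H →L[ℂ] H} {φ : H} (hf : IsFrame (fun n : ℕ => (T ^ n) φ)) (k : ℕ) :
    IsClosed ((T ^ k).range : Set H) := by
  have hsum := hf.summable_norm_inner_sq
  obtain ⟨A, B, hA, hB, h⟩ := hf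
  let F := Submodule.span ℂ ((fun n : ℕ => (T ^ n) φ) '' (Finset.range k : Set ℕ))
  have : FiniteDimensional ℂ F :=
    FiniteDimensional.span_of_finite ℂ ((Finset.finite_toSet _).image _)
  refine isClosed_range_of_adjoint_bounded_below (T ^ k) F (div_pos hA hB) fun x hx => ?_
  rw [div_mul_eq_mul_div, div_le_iff₀ hB, mul_comm _ B]
  refine ((h x).1.trans_eq ?_).trans (h _).2
  rw [← (hsum x).sum_add_tsum_nat_add k, Finset.sum_eq_zero, zero_add]
  · refine tsum_congr fun n => ?_
    rw [ContinuousLinearMap.adjoint_inner_left, ← mul_apply_eq_comp, ← pow_add,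
      add_comm]
  · intro n hn
    rw [Submodule.inner_left_of_mem_orthogonal
      (Submodule.subset_span (Set.mem_image_of_mem _ (Finset.mem_coe.2 hn))) hx]
    simp

/-- If `{T^n φ}` is a frame for `H` with `T` bounded, then for every `k` the range of
`T^k` equals the closed span of `{T^n φ : n ≥ k}`. -/
theorem stmt10 {H : Type*} [NormedAddCommGroup H] [InnerProductSpace ℂ H] [CompleteSpace H]
    (T : H →L[ℂ] H) (φ : H) (hf : IsFrame (fun n : ℕ => (T ^ n) φ)) :
    ∀ k : ℕ, Set.range ⇑(T ^ k) =
      ((Submodule.span ℂ (Set.range fun n : ℕ => (T ^ (k + n)) φ)).topologicalClosure : Set H) := by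
  intro k
  have hmap : Submodule.span ℂ (Set.range fun n : ℕ => (T ^ (k + n)) φ) =
      (Submodule.span ℂ (Set.range fun n : ℕ => (T ^ n) φ)).map
        ((T ^ k : H →L[ℂ] H) : H →ₗ[ℂ] H) := by
    rw [Submodule.map_span, ← Set.range_comp]
    simp only [Function.comp_def, pow_add, mul_apply_eq_comp,
      ContinuousLinearMap.coe_coe]
  apply Set.Subset.antisymm
  · rintro _ ⟨x, rfl⟩
    rw [hmap]
    refine Submodule.topologicalClosure_map _ _ (Submodule.mem_map_of_mem ?_)
    rw [hf.topologicalClosure_span_eq_top]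
    trivial
  · refine Submodule.topologicalClosure_minimal _ (t := (T ^ k).range) ?_ (hf.isClosed_range_pow k)
    rw [hmap]
    exact LinearMap.map_le_range
end

section
/- Let {T^n φ} (n ≥ 0) be an overcomplete frame for H with T bounded, let q be the length of the image chain of T, and let V = closed span of {T^n φ : n ≥ q}. Then V is invariant under T and T restricted to V is surjective onto V. -/
open scoped ComplexInnerProductSpace

section

open ContinuousLinearMap

theorem IsFrame.memℓp_inner {ι H : Type*} [NormedAddCommGroup H] [InnerProductSpace ℂ H]
    {f : ι → H} (hf : IsFrame f) (x : H) : Memℓp (fun i => ⟪f i, x⟫) 2 := by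
  obtain ⟨A, B, hA, -, h⟩ := hf
  refine memℓp_gen ?_
  by_contra hs
  have hx : x ≠ 0 := by
    rintro rfl
    exact hs (by simp)
  have hs' : ¬ Summable fun i => ‖⟪x, f i⟫‖ ^ 2 := by
    simpa [norm_inner_symm x] using hs
  have hle := (h x).1
  rw [tsum_eq_zero_of_not_summable hs'] at hle
  have : 0 < A * ‖x‖ ^ 2 := by positivity
  linarith

theorem lp_two_norm_sq {ι : Type*} (c : lp (fun _ : ι => ℂ) 2) :
    ‖c‖ ^ 2 = ∑' i, ‖c i‖ ^ 2 := by
  have := lp.norm_rpow_eq_tsum (p := 2) (by norm_num) c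
  simpa using this

/-- Every vector has a square-summable expansion in a frame. -/
theorem IsFrame.exists_hasSum {ι H : Type*} [NormedAddCommGroup H] [InnerProductSpace ℂ H]
    [CompleteSpace H] {f : ι → H} (hf : IsFrame f) :
    ∃ L : lp (fun _ : ι => ℂ) 2 →L[ℂ] H, Function.Surjective L ∧
      ∀ c, HasSum (fun i => c i • f i) (L c) := by
  classical
  have hmem := hf.memℓp_inner
  obtain ⟨A, B, hA, hB, h⟩ := hf
  let C₀ : H →ₗ[ℂ] lp (fun _ : ι => ℂ) 2 :=
    { toFun := fun x => ⟨fun i => ⟪f i, x⟫, hmem x⟩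
      map_add' := fun x y => Subtype.ext (funext fun i => inner_add_right _ _ _)
      map_smul' := fun a x => Subtype.ext (funext fun i => inner_smul_right _ _ _) }
  have hC₀ (x : H) : ‖C₀ x‖ ^ 2 = ∑' i, ‖⟪x, f i⟫‖ ^ 2 := by
    rw [lp_two_norm_sq]
    exact tsum_congr fun i => by rw [norm_inner_symm x]; rfl
  let C : H →L[ℂ] lp (fun _ : ι => ℂ) 2 := C₀.mkContinuous (√B) fun x => by
    refine le_of_sq_le_sq ?_ (by positivity)
    rw [hC₀, mul_pow, Real.sq_sqrt hB.le]
    exact (h x).2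
  have hC (x : H) : A * ‖x‖ ^ 2 ≤ ‖C x‖ ^ 2 := (h x).1.trans_eq (hC₀ x).symm
  refine ⟨adjoint C, ?_, fun c => ?_⟩
  · have hu : IsUnit ((adjoint C) ∘L C) := by
      refine isUnit_of_forall_le_norm_inner_map _ (c := ⟨A, hA.le⟩) hA fun x => ?_
      rw [coe_comp, Function.comp_apply, adjoint_inner_left, inner_self_eq_norm_sq_to_K]
      rw [mul_comm]
      change A * ‖x‖ ^ 2 ≤ _
      simpa using hC x
    exact Function.Surjective.of_comp (isUnit_iff_bijective.1 hu).2
  · have hsingle (i : ι) (a : ℂ) : adjoint C (lp.single 2 i a) = a • f i := by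
      refine ext_inner_right ℂ fun x => ?_
      rw [adjoint_inner_left, lp.inner_single_left, inner_smul_left]
      change inner ℂ a ⟪f i, x⟫ = _
      simp [mul_comm]
    have := (lp.hasSum_single (by norm_num) c).map (adjoint C) (adjoint C).continuous
    simpa [Function.comp_def, hsingle] using this

/-- A bounded operator from a Hilbert space to a Banach space whose range has finite codimension
has closed range. -/
theorem ContinuousLinearMap.isClosed_range_of_finiteDimensional_quotient {E F : Type*}
    [NormedAddCommGroup E] [InnerProductSpace ℂ E] [CompleteSpace E]
    [NormedAddCommGroup F] [NormedSpace ℂ F] [CompleteSpace F] (f : E →L[ℂ] F)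
    [FiniteDimensional ℂ (F ⧸ f.range)] : IsClosed (f.range : Set F) := by
  have hkc : IsClosed (f.ker : Set E) := f.isClosed_ker
  have : CompleteSpace f.ker := hkc.completeSpace_coe
  let g : f.kerᗮ →L[ℂ] F := f ∘L f.kerᗮ.subtypeL
  have hg : g.range = f.range := by
    ext y
    constructor
    · rintro ⟨x, rfl⟩
      exact ⟨x, rfl⟩
    · rintro ⟨x, rfl⟩
      obtain ⟨a, ha, b, hb, rfl⟩ := f.ker.exists_add_mem_mem_orthogonal x
      have ha' : f a = 0 := ha
      exact ⟨⟨b, hb⟩, by simp [g, ha']⟩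
  have hker : g.ker = ⊥ := by
    refine (Submodule.eq_bot_iff _).2 fun x hx => ?_
    have hx' : (x : E) ∈ f.ker := hx
    exact Subtype.ext (inner_self_eq_zero.1 (x.2 x hx'))
  obtain ⟨G, hG⟩ := Submodule.exists_isCompl f.range
  have : FiniteDimensional ℂ G := (Submodule.quotientEquivOfIsCompl _ _ hG).finiteDimensional
  rw [← hg] at hG ⊢
  exact closed_complemented_range_of_isCompl_of_ker_eq_bot g G hG G.closed_of_finiteDimensional
    hker

theorem isClosed_range_pow_of_isFrame {H : Type*} [NormedAddCommGroup H] [InnerProductSpace ℂ H]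
    [CompleteSpace H] {T : H →L[ℂ] H} {φ : H} (hf : IsFrame fun n : ℕ => (T ^ n) φ) (q : ℕ) :
    IsClosed (Set.range ⇑(T ^ q)) := by
  obtain ⟨L, hL, hsum⟩ := hf.exists_hasSum
  let W : Submodule ℂ H := Submodule.span ℂ ((fun n => (T ^ n) φ) '' Finset.range q)
  have : FiniteDimensional ℂ W :=
    FiniteDimensional.span_of_finite ℂ ((Finset.range q).finite_toSet.image _)
  have hdec (x : H) : ∃ w ∈ W, ∃ y, w + (T ^ q) y = x := by
    obtain ⟨c, rfl⟩ := hL x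
    have hc : Memℓp (fun n => c (n + q)) 2 := by
      refine memℓp_gen ?_
      exact (summable_nat_add_iff q).2 ((memℓp_gen_iff (by norm_num)).1 (lp.memℓp c))
    refine ⟨∑ n ∈ Finset.range q, c n • (T ^ n) φ, ?_, L ⟨_, hc⟩, ?_⟩
    · exact Submodule.sum_mem _ fun n hn =>
        W.smul_mem _ (Submodule.subset_span ⟨n, by simpa using hn, rfl⟩)
    · have h₁ := (hsum ⟨_, hc⟩).map (T ^ q) (T ^ q).continuous
      have h₂ := (hasSum_nat_add_iff' q).2 (hsum c)
      have h₃ : (⇑(T ^ q) ∘ fun n => c (n + q) • (T ^ n) φ) =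
          fun n => c (n + q) • (T ^ (n + q)) φ := by
        funext n
        rw [Function.comp_apply, map_smul, add_comm n q, pow_add]
        rfl
      rw [← h₃] at h₂
      rw [h₁.unique h₂]
      abel
  have : FiniteDimensional ℂ (H ⧸ (T ^ q).range) := by
    refine Module.Finite.of_surjective ((T ^ q).range.mkQ ∘ₗ W.subtype) fun z => ?_
    obtain ⟨x, rfl⟩ := Submodule.mkQ_surjective _ z
    obtain ⟨w, hw, y, rfl⟩ := hdec x
    refine ⟨⟨w, hw⟩, ?_⟩
    have : (T ^ q).range.mkQ ((T ^ q) y) = 0 := (Submodule.Quotient.mk_eq_zero _).2 ⟨y, rfl⟩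
    rw [map_add, this, add_zero]
    rfl
  exact (T ^ q).isClosed_range_of_finiteDimensional_quotient

theorem coe_topologicalClosure_span_pow {H : Type*} [NormedAddCommGroup H]
    [InnerProductSpace ℂ H] [CompleteSpace H] {T : H →L[ℂ] H} {φ : H}
    (hf : IsFrame fun n : ℕ => (T ^ n) φ) (q : ℕ) :
    ((Submodule.span ℂ (Set.range fun n : ℕ => (T ^ (q + n)) φ)).topologicalClosure : Set H) =
      Set.range ⇑(T ^ q) := by
  apply Set.Subset.antisymm
  · rw [Submodule.topologicalClosure_coe]
    refine closure_minimal ?_ (isClosed_range_pow_of_isFrame hf q)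
    have : Submodule.span ℂ (Set.range fun n : ℕ => (T ^ (q + n)) φ) ≤ (T ^ q).range := by
      rw [Submodule.span_le]
      rintro _ ⟨n, rfl⟩
      exact ⟨(T ^ n) φ, by simp only [pow_add]; rfl⟩
    exact fun x hx => this hx
  · rintro _ ⟨x, rfl⟩
    obtain ⟨L, hL, hsum⟩ := hf.exists_hasSum
    obtain ⟨c, rfl⟩ := hL x
    refine (Submodule.isClosed_topologicalClosure _).mem_of_tendsto
      ((hsum c).map (T ^ q) (T ^ q).continuous) (.of_forall fun s => ?_)
    refine Submodule.sum_mem _ fun n _ => Submodule.le_topologicalClosure _ ?_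
    rw [Function.comp_apply, map_smul]
    exact Submodule.smul_mem _ _ (Submodule.subset_span ⟨n, by simp [pow_add]⟩)

end

/-- If `{T^n φ}` is an overcomplete frame for `H`, `q` is the length of the (finite) image
chain of `T`, and `V` is the closed span of `{T^n φ : n ≥ q}`, then `V` is `T`-invariant
and `T : V → V` is surjective. -/
theorem stmt11 {H : Type*} [NormedAddCommGroup H] [InnerProductSpace ℂ H] [CompleteSpace H]
    (T : H →L[ℂ] H) (φ : H) (q : ℕ)
    (hf : IsFrame (fun n : ℕ => (T ^ n) φ))
    (hover : ∃ c : ℕ → ℂ, c ≠ 0 ∧ Summable (fun n => ‖c n‖ ^ 2) ∧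
      HasSum (fun n => c n • (T ^ n) φ) (0 : H))
    (hq : Set.range ⇑(T ^ q) = Set.range ⇑(T ^ (q + 1)))
    (hqmin : ∀ m < q, Set.range ⇑(T ^ m) ≠ Set.range ⇑(T ^ (m + 1))) :
    (∀ v ∈ ((Submodule.span ℂ (Set.range fun n : ℕ => (T ^ (q + n)) φ)).topologicalClosure : Set H),
        T v ∈ ((Submodule.span ℂ (Set.range fun n : ℕ => (T ^ (q + n)) φ)).topologicalClosure : Set H)) ∧
      ∀ v ∈ ((Submodule.span ℂ (Set.range fun n : ℕ => (T ^ (q + n)) φ)).topologicalClosure : Set H),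
        ∃ w ∈ ((Submodule.span ℂ (Set.range fun n : ℕ => (T ^ (q + n)) φ)).topologicalClosure : Set H),
          T w = v := by
  rw [coe_topologicalClosure_span_pow hf]
  refine ⟨?_, ?_⟩
  · rintro _ ⟨x, rfl⟩
    rw [hq]
    exact ⟨x, by simp [pow_succ']⟩
  · intro v hv
    rw [hq] at hv
    obtain ⟨x, rfl⟩ := hv
    exact ⟨(T ^ q) x, ⟨x, rfl⟩, by simp [pow_succ']⟩
end
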